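/- Let n ≥ 1, let A be the polynomial ring over ℚ in indeterminates a₂, …, a_{n+1}, let f = x^{n+1} + Σ_{j=2}^{n+1} a_j x^{n+1−j} ∈ A[x], let B = A[x]/(f), free as an A-module with basis 1, x, …, x^n, and let π_! : B → A be the A-linear map taking the coefficient of x^n in this basis. Then the n elements π_!(x^{n+2}), π_!(x^{n+3}), …, π_!(x^{2n+1}) of A are algebraically independent over ℚ and generate A as a ℚ-algebra. -/

import Mathlib

/-!
Statement 5: the n elements π_!(x^{n+2}), …, π_!(x^{2n+1}) of A = ℚ[a₂,…,a_{n+1}]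
are algebraically independent over ℚ and generate A as a ℚ-algebra, where
B = A[x]/(x^{n+1} + a₂x^{n−1} + ⋯ + a_{n+1}) and π_! extracts the coefficient of x^n.
-/

noncomputable section

open Polynomial

/-- The polynomial ring A = ℚ[a₂,…,a_{n+1}]. -/
abbrev ARing (n : ℕ) : Type := MvPolynomial {j : ℕ // 2 ≤ j ∧ j ≤ n + 1} ℚ

/-- The element a_j, with conventions a₀ = 1, a₁ = 0 (and a_j = 0 for j > n+1). -/
def aGen (n : ℕ) (j : ℕ) : ARing n :=
  if j = 0 then 1 else if h : 2 ≤ j ∧ j ≤ n + 1 then MvPolynomial.X ⟨j, h⟩ else 0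

/-- The monic polynomial f = x^{n+1} + Σ_{j=2}^{n+1} a_j x^{n+1−j}. -/
def fPoly (n : ℕ) : Polynomial (ARing n) :=
  X ^ (n + 1) + ∑ j ∈ Finset.Icc 2 (n + 1), C (aGen n j) * X ^ (n + 1 - j)

/-- π_! : B = A[x]/(f) → A, the A-linear functional extracting the coefficient of x^n in
the basis 1, x, …, x^n; computed on the canonical representative modulo the monic f. -/
def piShriek (n : ℕ) (g : Polynomial (ARing n)) : ARing n := (g %ₘ fPoly n).coeff n

/-- The family π_!(x^{n+2}), π_!(x^{n+3}), …, π_!(x^{2n+1}). -/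
def kappaFam (n : ℕ) : Fin n → ARing n := fun i => piShriek n (X ^ (n + 2 + (i : ℕ)))

/-- The part of `fPoly n` below its leading term has degree less than `n + 1`. -/
lemma degree_fPoly_tail_lt (n : ℕ) :
    (∑ j ∈ Finset.Icc 2 (n + 1), C (aGen n j) * X ^ (n + 1 - j)).degree
      < ((n + 1 : ℕ) : WithBot ℕ) := by
  refine (degree_sum_le _ _).trans_lt
    ((Finset.sup_lt_iff (WithBot.bot_lt_coe _)).2 fun j hj => ?_)
  rw [Finset.mem_Icc] at hj
  exact (degree_C_mul_X_pow_le _ _).trans_lt (Nat.cast_lt.2 (by omega))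

lemma fPoly_monic (n : ℕ) : (fPoly n).Monic :=
  monic_X_pow_add (degree_fPoly_tail_lt n)

lemma degree_fPoly (n : ℕ) : (fPoly n).degree = ((n + 1 : ℕ) : WithBot ℕ) := by
  rw [fPoly, degree_add_eq_left_of_degree_lt, degree_X_pow]
  rw [degree_X_pow]
  exact degree_fPoly_tail_lt n

/-- `piShriek` as an `ARing n`-linear map. -/
def piShriekHom (n : ℕ) : (ARing n)[X] →ₗ[ARing n] ARing n :=
  lcoeff (ARing n) n ∘ₗ modByMonicHom (fPoly n)

lemma piShriekHom_apply (n : ℕ) (g : (ARing n)[X]) : piShriekHom n g = piShriek n g := rfl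

lemma piShriek_X_pow_of_le {n k : ℕ} (hk : k ≤ n) :
    piShriek n (X ^ k) = if n = k then 1 else 0 := by
  have h : (X ^ k : (ARing n)[X]) %ₘ fPoly n = X ^ k := by
    rw [modByMonic_eq_self_iff (fPoly_monic n), degree_fPoly, degree_X_pow]
    exact Nat.cast_lt.2 (by omega)
  rw [piShriek, h, coeff_X_pow]

/-- The linear recurrence satisfied by the values of `π_!` on powers of `x`. -/
lemma piShriek_X_pow_add (n k : ℕ) :
    piShriek n (X ^ (n + 1 + k)) =
      -∑ j ∈ Finset.Icc 2 (n + 1), aGen n j * piShriek n (X ^ (n + 1 + k - j)) := by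
  have h0 : piShriekHom n (X ^ k * fPoly n) = 0 := by
    rw [piShriekHom_apply, piShriek, mul_self_modByMonic (fPoly_monic n), coeff_zero]
  have h1 : X ^ k * fPoly n = X ^ (n + 1 + k) +
      ∑ j ∈ Finset.Icc 2 (n + 1), aGen n j • (X : (ARing n)[X]) ^ (n + 1 + k - j) := by
    rw [fPoly, mul_add, ← pow_add, add_comm k, Finset.mul_sum]
    congr 1
    refine Finset.sum_congr rfl fun j hj => ?_
    rw [Finset.mem_Icc] at hj
    rw [smul_eq_C_mul, mul_left_comm, ← pow_add]
    congr 2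
    omega
  rw [h1, map_add, map_sum] at h0
  simp only [map_smul, piShriekHom_apply, smul_eq_mul] at h0
  exact eq_neg_of_add_eq_zero_left h0

lemma piShriek_X_pow_succ (n : ℕ) : piShriek n (X ^ (n + 1)) = 0 := by
  have h := piShriek_X_pow_add n 0
  rw [add_zero] at h
  rw [h, neg_eq_zero]
  refine Finset.sum_eq_zero fun j hj => ?_
  rw [Finset.mem_Icc] at hj
  rw [piShriek_X_pow_of_le (by omega), if_neg (by omega), mul_zero]

lemma piShriek_X_pow_mem_adjoin {n k : ℕ} (hk : k ≤ 2 * n + 1) :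
    piShriek n (X ^ k) ∈ Algebra.adjoin ℚ (Set.range (kappaFam n)) := by
  rcases le_or_gt k n with h | h
  · rw [piShriek_X_pow_of_le h]
    split_ifs
    exacts [one_mem _, zero_mem _]
  · obtain rfl | h := (Nat.succ_le_of_lt h).eq_or_lt
    · rw [Nat.succ_eq_add_one, piShriek_X_pow_succ]
      exact zero_mem _
    · refine Algebra.subset_adjoin ⟨⟨k - (n + 2), by omega⟩, ?_⟩
      rw [kappaFam]
      congr 2
      change n + 2 + (k - (n + 2)) = k
      omega

lemma aGen_mem_adjoin {n : ℕ} (m : ℕ) (hm : m ∈ Finset.Icc 2 (n + 1)) :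
    aGen n m ∈ Algebra.adjoin ℚ (Set.range (kappaFam n)) := by
  induction m using Nat.strong_induction_on with
  | _ m ih =>
    have hm' := Finset.mem_Icc.1 hm
    have h := piShriek_X_pow_add n (m - 1)
    rw [← Finset.add_sum_erase _ _ hm, show n + 1 + (m - 1) - m = n by omega,
      piShriek_X_pow_of_le le_rfl, if_pos rfl, mul_one] at h
    rw [eq_neg_iff_add_eq_zero, add_left_comm] at h
    rw [eq_neg_of_add_eq_zero_left h]
    refine neg_mem (add_mem (piShriek_X_pow_mem_adjoin (by omega))
      (sum_mem fun j hj => ?_))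
    obtain ⟨hjm, hj⟩ := Finset.mem_erase.1 hj
    have hj' := Finset.mem_Icc.1 hj
    rcases lt_or_gt_of_ne hjm with hlt | hgt
    · exact mul_mem (ih j hlt hj) (piShriek_X_pow_mem_adjoin (by omega))
    · rw [piShriek_X_pow_of_le (by omega), if_neg (by omega), mul_zero]
      exact zero_mem _

lemma adjoin_range_kappaFam (n : ℕ) : Algebra.adjoin ℚ (Set.range (kappaFam n)) = ⊤ := by
  rw [eq_top_iff, ← MvPolynomial.adjoin_range_X, Algebra.adjoin_le_iff]
  rintro _ ⟨⟨j, hj⟩, rfl⟩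
  have h := aGen_mem_adjoin j (Finset.mem_Icc.2 hj)
  rwa [aGen, if_neg (by omega), dif_pos hj] at h

lemma trdeg_ARing (n : ℕ) : Algebra.trdeg ℚ (ARing n) = n := by
  have e : {j : ℕ // 2 ≤ j ∧ j ≤ n + 1} ≃ Finset.Icc 2 (n + 1) :=
    Equiv.subtypeEquivRight fun j => Finset.mem_Icc.symm
  rw [MvPolynomial.trdeg_of_isDomain, Cardinal.lift_id, Cardinal.mk_congr e, Cardinal.mk_coe_finset,
    Nat.card_Icc]
  congr 1

theorem stmt5 (n : ℕ) (hn : 1 ≤ n) :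
    AlgebraicIndependent ℚ (kappaFam n) ∧
    Algebra.adjoin ℚ (Set.range (kappaFam n)) = ⊤ := by
  have h := adjoin_range_kappaFam n
  have : Algebra.IsAlgebraic (Algebra.adjoin ℚ (Set.range (kappaFam n))) (ARing n) :=
    ⟨fun a => isAlgebraic_algebraMap (⟨a, h ▸ Algebra.mem_top⟩ :
      Algebra.adjoin ℚ (Set.range (kappaFam n)))⟩
  refine ⟨(Algebra.IsAlgebraic.isTranscendenceBasis_of_le_trdeg_of_finite ℚ (kappaFam n) ?_).1, h⟩
  rw [trdeg_ARing, Cardinal.mk_fin]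

end
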